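/- arXiv:2507.02930 — 2 statements merged into one kernel-verified Lean document; each statement's English description precedes it below -/
import Mathlib

section
/- Let n be an odd, squarefree, composite integer with n ≥ 4 such that (∏_{p ∣ n} (p − 2)) divides φ(n) − 1, where the product runs over the distinct prime divisors of n and φ is Euler's totient function. Assume moreover that (φ(n) − 1)/∏_{p ∣ n}(p − 2) ≥ 3. Then the number of distinct prime divisors of n is at least 17, i.e., ω(n) ≥ 17. -/
/-- If every element of `s` outside `t` has weight at most `c`, every element of `t` outside `s`
has weight at least `c ≥ 1`, and `s` has at most as many elements as `t`, then the product of the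
weights over `s` is at most the product over `t`. -/
lemma prod_le_prod_of_card_le {α : Type*} [DecidableEq α] {s t : Finset α} {f : α → ℚ} {c : ℚ}
    (hc : 1 ≤ c) (hf : ∀ x ∈ s, 0 ≤ f x) (hs : ∀ x ∈ s, x ∉ t → f x ≤ c)
    (ht : ∀ x ∈ t, c ≤ f x) (hcard : s.card ≤ t.card) :
    ∏ x ∈ s, f x ≤ ∏ x ∈ t, f x := by
  rw [← Finset.prod_inter_mul_prod_sdiff s t f, ← Finset.prod_inter_mul_prod_sdiff t s f,
    Finset.inter_comm t s]
  refine mul_le_mul_of_nonneg_left ?_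
    (Finset.prod_nonneg fun x hx => hf x (Finset.mem_inter.1 hx).1)
  calc ∏ x ∈ s \ t, f x ≤ ∏ _x ∈ s \ t, c := by
        refine Finset.prod_le_prod (fun x hx => ?_) fun x hx => ?_ <;>
          rw [Finset.mem_sdiff] at hx
        exacts [hf x hx.1, hs x hx.1 hx.2]
    _ = c ^ (s \ t).card := Finset.prod_const c
    _ ≤ c ^ (t \ s).card := by
        refine pow_le_pow_right₀ hc ?_
        have h₁ := Finset.card_sdiff_add_card_inter s t
        have h₂ := Finset.card_sdiff_add_card_inter t s
        rw [Finset.inter_comm] at h₂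
        omega
    _ = ∏ _x ∈ t \ s, c := (Finset.prod_const c).symm
    _ ≤ ∏ x ∈ t \ s, f x :=
        Finset.prod_le_prod (fun _ _ => by linarith) fun x hx =>
          ht x (Finset.mem_sdiff.1 hx).1

/-- The function `x ↦ (x - 1) / (x - 2)` is antitone on integers exceeding `2`. -/
lemma sub_one_div_sub_two_anti {a b : ℕ} (ha : 3 ≤ a) (hab : a ≤ b) :
    ((b : ℚ) - 1) / (b - 2) ≤ ((a : ℚ) - 1) / (a - 2) := by
  have ha' : (3 : ℚ) ≤ a := by exact_mod_cast ha
  have hab' : (a : ℚ) ≤ b := by exact_mod_cast hab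
  rw [div_le_div_iff₀ (by linarith) (by linarith)]
  nlinarith

/-- Comparison of `∏ (x - 1) / (x - 2)` over `s` with the product over `t`, where `t` contains all
elements of `s` that are less than `b`. -/
lemma prod_sub_one_div_sub_two_le {s t : Finset ℕ} {b : ℕ} (hb : 3 ≤ b) (hs : ∀ x ∈ s, 3 ≤ x)
    (hst : ∀ x ∈ s, x < b → x ∈ t) (ht : ∀ x ∈ t, 3 ≤ x ∧ x ≤ b) (hcard : s.card ≤ t.card) :
    ∏ x ∈ s, ((x : ℚ) - 1) / (x - 2) ≤ ∏ x ∈ t, ((x : ℚ) - 1) / (x - 2) := by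
  have hb' : (3 : ℚ) ≤ b := by exact_mod_cast hb
  refine prod_le_prod_of_card_le (c := ((b : ℚ) - 1) / (b - 2)) ?_ ?_ ?_ ?_ hcard
  · rw [one_le_div (by linarith)]
    linarith
  · intro x hx
    have : (3 : ℚ) ≤ x := by exact_mod_cast hs x hx
    exact div_nonneg (by linarith) (by linarith)
  · intro x hx hxt
    exact sub_one_div_sub_two_anti hb (not_lt.1 fun h => hxt (hst x hx h))
  · intro x hx
    exact sub_one_div_sub_two_anti (ht x hx).1 (ht x hx).2

lemma prod_lt_three {s : Finset ℕ} (hs : ∀ x ∈ s, x % 6 = 5) (hcard : s.card ≤ 16) :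
    ∏ x ∈ s, ((x : ℚ) - 1) / (x - 2) < 3 := by
  refine (prod_sub_one_div_sub_two_le (b := 101)
    (t := {5, 11, 17, 23, 29, 35, 41, 47, 53, 59, 65, 71, 77, 83, 89, 95})
    (by norm_num) ?_ ?_ (by decide) (hcard.trans (by decide))).trans_lt (by norm_num)
  · intro x hx
    have := hs x hx
    omega
  · intro x hx hlt
    have := hs x hx
    simp only [Finset.mem_insert, Finset.mem_singleton]
    omega

lemma prod_lt_five {s : Finset ℕ} (hs : ∀ x ∈ s, x = 3 ∨ 7 ≤ x ∧ (x % 6 = 1 ∨ x % 6 = 5))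
    (hcard : s.card ≤ 16) :
    ∏ x ∈ s, ((x : ℚ) - 1) / (x - 2) < 5 := by
  refine (prod_sub_one_div_sub_two_le (b := 50)
    (t := {3, 7, 11, 13, 17, 19, 23, 25, 29, 31, 35, 37, 41, 43, 47, 49})
    (by norm_num) ?_ ?_ (by decide) (hcard.trans (by decide))).trans_lt (by norm_num)
  · intro x hx
    have := hs x hx
    omega
  · intro x hx hlt
    have := hs x hx
    simp only [Finset.mem_insert, Finset.mem_singleton]
    omega

lemma totient_eq_prod_of_squarefree {n : ℕ} (h : Squarefree n) :
    n.totient = ∏ p ∈ n.primeFactors, (p - 1) := by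
  rw [Nat.totient_eq_div_primeFactors_mul, Nat.prod_primeFactors_of_squarefree h,
    Nat.div_self (Nat.pos_of_ne_zero h.ne_zero), one_mul]

/-- If `φ(n) ≡ 1 (mod 3)` for an odd squarefree `n`, all prime factors of `n` are `5` modulo `6`. -/
lemma mod_six_of_three_dvd {n : ℕ} (hodd : Odd n) (hsqf : Squarefree n)
    (h : n.totient % 3 = 1) : ∀ p ∈ n.primeFactors, p % 6 = 5 := by
  have hφ := totient_eq_prod_of_squarefree hsqf
  have hmod : ∀ p ∈ n.primeFactors, p % 3 ≠ 1 := by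
    intro p hp h₁
    have hd : p - 1 ∣ n.totient := hφ ▸ Finset.dvd_prod_of_mem (fun p => p - 1) hp
    have : 3 ∣ n.totient := (show 3 ∣ p - 1 by omega).trans hd
    omega
  have hdiv : ∀ p ∈ n.primeFactors, p % 3 = 0 → p = 3 := fun p hp h₀ =>
    ((Nat.prime_dvd_prime_iff_eq Nat.prime_three (Nat.prime_of_mem_primeFactors hp)).1
      (Nat.dvd_of_mod_eq_zero h₀)).symm
  have hthree : 3 ∉ n.primeFactors := by
    intro h3
    rw [← Finset.mul_prod_erase _ _ h3] at hφ
    have hone : (∏ p ∈ n.primeFactors.erase 3, (p - 1)) ≡ 1 [MOD 3] := by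
      refine (Nat.ModEq.prod (g := fun _ => 1) fun p hp => ?_).trans (by simp [Nat.ModEq])
      obtain ⟨hne, hp⟩ := Finset.mem_erase.1 hp
      have h₁ := hmod p hp
      have h₀ := mt (hdiv p hp) hne
      simp only [Nat.ModEq]
      omega
    simp only [Nat.ModEq] at hone
    omega
  intro p hp
  have h₁ := hmod p hp
  have h₀ : p % 3 ≠ 0 := fun h₀ => hthree (hdiv p hp h₀ ▸ hp)
  have h₂ : p % 2 = 1 := Nat.odd_iff.1 (hodd.of_dvd_nat (Nat.dvd_of_mem_primeFactors hp))
  omega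

theorem stmt_2 (n : ℕ) (hodd : Odd n) (hsqf : Squarefree n) (hcomp : ¬ n.Prime)
    (hn : 4 ≤ n)
    (hdvd : (∏ p ∈ n.primeFactors, (p - 2)) ∣ Nat.totient n - 1)
    (hM : 3 ≤ (Nat.totient n - 1) / ∏ p ∈ n.primeFactors, (p - 2)) :
    17 ≤ n.primeFactors.card := by
  by_contra! hlt
  have hcard : n.primeFactors.card ≤ 16 := by omega
  have hp2 : ∀ p ∈ n.primeFactors, p % 2 = 1 := fun p hp =>
    Nat.odd_iff.1 (hodd.of_dvd_nat (Nat.dvd_of_mem_primeFactors hp))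
  have hp3 : ∀ p ∈ n.primeFactors, 3 ≤ p := fun p hp => by
    have h₁ := (Nat.prime_of_mem_primeFactors hp).two_le
    have h₂ := hp2 p hp
    omega
  have hφ := totient_eq_prod_of_squarefree hsqf
  have hpos : 0 < n.totient := Nat.totient_pos.2 (by omega)
  have heven : n.totient % 2 = 0 := Nat.even_iff.1 (Nat.totient_even (by omega))
  set S := ∏ p ∈ n.primeFactors, (p - 2) with hS
  set M := (n.totient - 1) / S
  have hMS : S * M = n.totient - 1 := Nat.mul_div_cancel' hdvd
  have hSpos : 0 < S := Finset.prod_pos fun p hp => by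
    have := hp3 p hp
    omega
  have hratio : ∏ p ∈ n.primeFactors, ((p : ℚ) - 1) / (p - 2) = n.totient / S := by
    rw [Finset.prod_div_distrib, hφ, hS, Nat.cast_prod, Nat.cast_prod]
    congr 1 <;> refine Finset.prod_congr rfl fun p hp => ?_
    · rw [Nat.cast_sub (by have := hp3 p hp; omega), Nat.cast_one]
    · rw [Nat.cast_sub (by have := hp3 p hp; omega), Nat.cast_ofNat]
  have hlow : ∀ m : ℕ, m ≤ M → (m : ℚ) < ∏ p ∈ n.primeFactors, ((p : ℚ) - 1) / (p - 2) := by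
    intro m hm
    rw [hratio, lt_div_iff₀ (by exact_mod_cast hSpos)]
    have : m * S ≤ S * M := by
      rw [mul_comm]
      exact Nat.mul_le_mul_left S hm
    have : m * S < n.totient := by omega
    exact_mod_cast this
  by_cases h3 : 3 ∣ n.totient - 1
  · exact absurd (hlow 3 hM) (not_lt.2
      (prod_lt_three (mod_six_of_three_dvd hodd hsqf (by omega)) hcard).le)
  · have hM3 : M ≠ 3 := fun h => h3 ⟨S, by rw [← hMS, h, mul_comm]⟩
    have hM4 : M ≠ 4 := fun h => by
      rw [h] at hMS
      omega
    refine absurd (hlow 5 (by omega)) (not_lt.2 (prod_lt_five (fun p hp => ?_) hcard).le)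
    have hne5 : p ≠ 5 := by
      rintro rfl
      exact h3 ((Finset.dvd_prod_of_mem (fun p => p - 2) hp).trans hdvd)
    have h₀ : p % 3 = 0 → p = 3 := fun h₀ =>
      ((Nat.prime_dvd_prime_iff_eq Nat.prime_three (Nat.prime_of_mem_primeFactors hp)).1
        (Nat.dvd_of_mod_eq_zero h₀)).symm
    have h₁ := hp3 p hp
    have h₂ := hp2 p hp
    omega
end

section
/- Let n be an odd, squarefree, composite integer with n ≥ 4 such that φ(n) − 1 = 3 · ∏_{p ∣ n} (p − 2), where the product runs over the distinct prime divisors of n and φ is Euler's totient function. Then 3 does not divide n. -/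
theorem Nat.totient_eq_prod_primeFactors_of_squarefree {n : ℕ} (hn : Squarefree n) :
    Nat.totient n = ∏ p ∈ n.primeFactors, (p - 1) := by
  have h := Nat.totient_mul_prod_primeFactors n
  rw [Nat.prod_primeFactors_of_squarefree hn, mul_comm] at h
  exact Nat.eq_of_mul_eq_mul_left (Nat.pos_of_ne_zero hn.ne_zero) h

/-- If `n` is squarefree, divisible by `3`, and `φ n` is prime to `3`, then every other prime factor
of `n` is `2` modulo `3`, so `φ n` is `2` modulo `3`. -/
theorem Nat.totient_mod_three_of_squarefree {n : ℕ} (hn : Squarefree n) (h3 : 3 ∣ n)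
    (hφ : ¬ 3 ∣ Nat.totient n) : Nat.totient n % 3 = 2 := by
  have hmem : 3 ∈ n.primeFactors := Nat.mem_primeFactors.2 ⟨Nat.prime_three, h3, hn.ne_zero⟩
  rw [Nat.totient_eq_prod_primeFactors_of_squarefree hn] at hφ ⊢
  have hprod : (∏ p ∈ n.primeFactors.erase 3, (p - 1)) ≡ 1 [MOD 3] := by
    refine Finset.prod_induction _ (fun a ↦ a ≡ 1 [MOD 3]) (fun a b ha hb ↦ ha.mul hb) rfl ?_
    intro p hp
    obtain ⟨hp3, hpn⟩ := Finset.mem_erase.1 hp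
    have hp' := Nat.prime_of_mem_primeFactors hpn
    have hnd : ¬ 3 ∣ p := fun hd ↦ hp3 ((Nat.prime_dvd_prime_iff_eq Nat.prime_three hp').1 hd).symm
    have hnd' : ¬ 3 ∣ p - 1 := fun hd ↦ hφ (hd.trans (Finset.dvd_prod_of_mem _ hpn))
    have := hp'.two_le
    unfold Nat.ModEq
    omega
  rw [← Finset.mul_prod_erase _ _ hmem]
  exact hprod.mul_left 2

theorem stmt_7 (n : ℕ) (hodd : Odd n) (hsqf : Squarefree n) (hcomp : ¬ n.Prime)
    (hn : 4 ≤ n)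
    (h : Nat.totient n - 1 = 3 * ∏ p ∈ n.primeFactors, (p - 2)) :
    ¬ (3 ∣ n) := by
  intro h3
  have hpos : 0 < Nat.totient n := Nat.totient_pos.2 (by omega)
  have hmod := Nat.totient_mod_three_of_squarefree hsqf h3 (by omega)
  omega
end
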